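/- Let G = (V, E) be a finite simple graph, take k = 1, and let D ⊆ V be a proper subset of V. Then the set of vertices u ∈ V \ D maximizing the objective-function increment Σ_{v ∈ V \ (D ∪ {u})} C(D ∪ {u}, v) − Σ_{v ∈ V \ D} C(D, v) coincides with the set of vertices u ∈ V \ D maximizing the number of vertices in the closed neighbourhood N[u] that are not dominated by D. (Core of Theorem 4: for k = 1 the vertex rankings used by the new greedy criterion and by the standard greedy criterion are the same.) -/

import Mathlib

/-- Coverage is the indicator of having a neighbour in the set. -/
theorem min_one_card_eq_ite {α : Type*} [DecidableEq α] (s : Finset α) :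
    (min 1 (s.card) : ℤ) = if s = ∅ then 0 else 1 := by
  split_ifs with h
  · simp [h]
  · have : 0 < s.card := Finset.card_pos.mpr (Finset.nonempty_iff_ne_empty.mpr h)
    omega

/-- Adding `u ∉ D` changes the objective function by one less than the number of
not-dominated vertices in the closed neighbourhood of `u`. -/
theorem objective_increment_eq_card_sub_one {V : Type*} [Fintype V] [DecidableEq V]
    (G : SimpleGraph V) [DecidableRel G.Adj] (D : Finset V) {u : V} (hu : u ∉ D) :
    ((∑ v ∈ (insert u D)ᶜ, (min 1 ((G.neighborFinset v ∩ insert u D).card) : ℤ)) -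
        ∑ v ∈ Dᶜ, (min 1 ((G.neighborFinset v ∩ D).card) : ℤ)) =
      (((insert u (G.neighborFinset u)).filter
        (fun v => v ∉ D ∧ G.neighborFinset v ∩ D = ∅)).card : ℤ) - 1 := by
  have hfilter : (insert u (G.neighborFinset u)).filter
      (fun v => v ∉ D ∧ G.neighborFinset v ∩ D = ∅) =
      Dᶜ.filter (fun v => v ∈ insert u (G.neighborFinset u) ∧ G.neighborFinset v ∩ D = ∅) := by
    ext v
    simp only [Finset.mem_filter, Finset.mem_compl]
    tauto
  have hcompl : Dᶜ = insert u (insert u D)ᶜ := by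
    ext v
    by_cases h : v = u <;> simp [h, hu]
  have hnot : u ∉ (insert u D)ᶜ := by simp
  have hsum : ∑ v ∈ (insert u D)ᶜ, (min 1 ((G.neighborFinset v ∩ insert u D).card) : ℤ) =
      ∑ v ∈ (insert u D)ᶜ, (min 1 ((G.neighborFinset v ∩ D).card) : ℤ) +
      ∑ v ∈ (insert u D)ᶜ,
        if v ∈ insert u (G.neighborFinset u) ∧ G.neighborFinset v ∩ D = ∅ then (1 : ℤ) else 0 := by
    rw [← Finset.sum_add_distrib]
    refine Finset.sum_congr rfl fun v hv => ?_
    have hvu : v ≠ u := by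
      rintro rfl
      exact hnot hv
    rw [min_one_card_eq_ite, min_one_card_eq_ite]
    by_cases hadj : G.Adj u v
    · have hmem : u ∈ G.neighborFinset v := by simpa using hadj.symm
      by_cases h : G.neighborFinset v ∩ D = ∅ <;>
        simp [Finset.inter_insert_of_mem hmem, hadj, h]
    · have hmem : u ∉ G.neighborFinset v := by simpa [G.adj_comm] using hadj
      simp [Finset.inter_insert_of_notMem hmem, hadj, hvu]
  rw [hfilter, Finset.card_filter, hsum, hcompl, Finset.sum_insert hnot, Finset.sum_insert hnot,
    min_one_card_eq_ite]
  push_cast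
  by_cases h : G.neighborFinset u ∩ D = ∅ <;>
    simp only [h, Finset.mem_insert_self, and_self, and_false, if_true, if_false] <;> ring

/-- core of Theorem 4: For `k = 1` and a proper subset `D ⊂ V`, the
maximizers (over `u ∈ V \ D`) of the objective-function increment coincide with the
maximizers of the number of not-dominated vertices in the closed neighbourhood `N[u]`. -/
theorem dom_argmax_increment_eq_argmax_closed_nbhd {V : Type*} [Fintype V] [DecidableEq V]
    (G : SimpleGraph V) [DecidableRel G.Adj] (D : Finset V) (hD : D ≠ Finset.univ) :
    {u : V | u ∉ D ∧ ∀ w : V, w ∉ D →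
        ((∑ v ∈ (insert w D)ᶜ, (min 1 ((G.neighborFinset v ∩ insert w D).card) : ℤ)) -
            ∑ v ∈ Dᶜ, (min 1 ((G.neighborFinset v ∩ D).card) : ℤ)) ≤
          ((∑ v ∈ (insert u D)ᶜ, (min 1 ((G.neighborFinset v ∩ insert u D).card) : ℤ)) -
            ∑ v ∈ Dᶜ, (min 1 ((G.neighborFinset v ∩ D).card) : ℤ))} =
    {u : V | u ∉ D ∧ ∀ w : V, w ∉ D →
        ((insert w (G.neighborFinset w)).filter
            (fun v => v ∉ D ∧ G.neighborFinset v ∩ D = ∅)).card ≤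
          ((insert u (G.neighborFinset u)).filter
            (fun v => v ∉ D ∧ G.neighborFinset v ∩ D = ∅)).card} := by
  ext u
  simp only [Set.mem_ofPred_eq]
  refine and_congr_right fun hu => forall₂_congr fun w hw => ?_
  rw [objective_increment_eq_card_sub_one G D hu, objective_increment_eq_card_sub_one G D hw]
  omega
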